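/- arXiv:1311.3324 — 4 statements merged into one kernel-verified Lean document; each statement's English description precedes it below -/
import Mathlib

section
/- Let Δt > 0, R > 0, and let η, η' : ℝ → ℝ be differentiable with R + η(z) > 0 for all z. Define the discrete ALE velocity field w : ℝ² → ℝ² by w(z, r) = (0, ((η'(z) − η(z))/(Δt · (R + η(z)))) · r). Then w is differentiable, its divergence satisfies div w(z, r) = (η'(z) − η(z))/(Δt · (R + η(z))) for all (z, r), and consequently 1 + Δt · div w(z, r) = (R + η'(z))/(R + η(z)), which equals the Jacobian determinant of the map φ(z, r) = (z, ((R + η'(z))/(R + η(z))) · r) (the geometric conservation law for this ALE mapping). -/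
/-- The divergence of a vector field `u : ℝ × ℝ → ℝ × ℝ` at `p`: the trace of the
Fréchet derivative, i.e. `∂₁u₁(p) + ∂₂u₂(p)`. -/
noncomputable def pdiv (u : ℝ × ℝ → ℝ × ℝ) (p : ℝ × ℝ) : ℝ :=
  (fderiv ℝ u p (1, 0)).1 + (fderiv ℝ u p (0, 1)).2

/-- The Fréchet derivative of the fibrewise scaling `(z, r) ↦ g z * r`. -/
theorem hasFDerivAt_comp_fst_mul_snd {g : ℝ → ℝ} (hg : Differentiable ℝ g) (p : ℝ × ℝ) :
    HasFDerivAt (fun q : ℝ × ℝ => g q.1 * q.2)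
      (g p.1 • ContinuousLinearMap.snd ℝ ℝ ℝ +
        p.2 • (deriv g p.1 • ContinuousLinearMap.fst ℝ ℝ ℝ)) p :=
  ((hg p.1).hasDerivAt.comp_hasFDerivAt p hasFDerivAt_fst).mul hasFDerivAt_snd

/-- The divergence of the vertical field `(z, r) ↦ (0, g z * r)` is `g z`. -/
theorem pdiv_zero_comp_fst_mul_snd {g : ℝ → ℝ} (hg : Differentiable ℝ g) (p : ℝ × ℝ) :
    pdiv (fun q : ℝ × ℝ => ((0 : ℝ), g q.1 * q.2)) p = g p.1 := by
  rw [pdiv, ((hasFDerivAt_const (0 : ℝ) p).prodMk (hasFDerivAt_comp_fst_mul_snd hg p)).fderiv]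
  simp

/-- The determinant of a lower triangular endomorphism of `ℝ × ℝ` fixing the first coordinate. -/
theorem det_fst_prod_lower (a b : ℝ) :
    ((ContinuousLinearMap.fst ℝ ℝ ℝ).prod
      (a • ContinuousLinearMap.snd ℝ ℝ ℝ + b • ContinuousLinearMap.fst ℝ ℝ ℝ)).det = a := by
  rw [ContinuousLinearMap.det, ← LinearMap.det_toMatrix (Module.Basis.finTwoProd ℝ),
    Matrix.det_fin_two]
  simp [LinearMap.toMatrix_apply]

/-- The Jacobian determinant of `(z, r) ↦ (z, g z * r)` is `g z`. -/
theorem det_fderiv_fst_comp_fst_mul_snd {g : ℝ → ℝ} (hg : Differentiable ℝ g) (p : ℝ × ℝ) :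
    (fderiv ℝ (fun q : ℝ × ℝ => (q.1, g q.1 * q.2)) p).det = g p.1 := by
  rw [(hasFDerivAt_fst.prodMk (hasFDerivAt_comp_fst_mul_snd hg p)).fderiv, smul_smul,
    det_fst_prod_lower]

/-- Geometric conservation law for the discrete ALE velocity
`w(z, r) = (0, ((η' z − η z)/(Δt (R + η z))) r)`: `w` is differentiable, its divergence
is `(η' z − η z)/(Δt (R + η z))`, and `1 + Δt div w = (R + η' z)/(R + η z)`, which is
the Jacobian determinant of the ALE map `φ(z, r) = (z, ((R + η' z)/(R + η z)) r)`. -/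
theorem discrete_ale_velocity_gcl (Δt R : ℝ) (hΔt : 0 < Δt) (hR : 0 < R)
    (η η' : ℝ → ℝ) (hη : Differentiable ℝ η) (hη' : Differentiable ℝ η')
    (hpos : ∀ z, 0 < R + η z) :
    Differentiable ℝ
        (fun p : ℝ × ℝ => ((0 : ℝ), ((η' p.1 - η p.1) / (Δt * (R + η p.1))) * p.2)) ∧
      (∀ p : ℝ × ℝ,
        pdiv (fun p : ℝ × ℝ => ((0 : ℝ), ((η' p.1 - η p.1) / (Δt * (R + η p.1))) * p.2)) p =
          (η' p.1 - η p.1) / (Δt * (R + η p.1))) ∧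
      (∀ p : ℝ × ℝ,
        1 + Δt * pdiv
            (fun p : ℝ × ℝ => ((0 : ℝ), ((η' p.1 - η p.1) / (Δt * (R + η p.1))) * p.2)) p =
          (R + η' p.1) / (R + η p.1)) ∧
      ∀ p : ℝ × ℝ,
        1 + Δt * pdiv
            (fun p : ℝ × ℝ => ((0 : ℝ), ((η' p.1 - η p.1) / (Δt * (R + η p.1))) * p.2)) p =
          (fderiv ℝ (fun q : ℝ × ℝ => (q.1, ((R + η' q.1) / (R + η q.1)) * q.2)) p).det := by
  have hw : Differentiable ℝ (fun z => (η' z - η z) / (Δt * (R + η z))) :=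
    (hη'.sub hη).div ((hη.const_add R).const_mul Δt) fun z => (mul_pos hΔt (hpos z)).ne'
  have hJ : Differentiable ℝ (fun z => (R + η' z) / (R + η z)) :=
    (hη'.const_add R).div (hη.const_add R) fun z => (hpos z).ne'
  have hdiv := pdiv_zero_comp_fst_mul_snd hw
  have hgcl : ∀ z, 1 + Δt * ((η' z - η z) / (Δt * (R + η z))) = (R + η' z) / (R + η z) := by
    intro z
    have h := (hpos z).ne'
    field_simp
    ring
  refine ⟨fun p => ((hasFDerivAt_const (0 : ℝ) p).prodMk
    (hasFDerivAt_comp_fst_mul_snd hw p)).differentiableAt, hdiv, fun p => ?_, fun p => ?_⟩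
  · rw [hdiv, hgcl]
  · rw [hdiv, hgcl, det_fderiv_fst_comp_fst_mul_snd hJ]
end

section
/- Let L, R > 0 and let η, η' : [0, L] → ℝ be continuously differentiable with R + η(z) > 0 and R + η'(z) > 0 for all z ∈ [0, L]; let φ(z, r) = (z, ((R + η'(z))/(R + η(z))) · r), a bijection from Ω_η onto Ω_{η'}. Let v, v' : ℝ² → ℝ² be such that ‖v‖² and ‖v'‖² are Lebesgue-integrable on Ω_η. Then ∫_{Ω_η} ⟨v' − v, v'⟩ d(z,r) + ½ ∫_{Ω_η} ((η'(z) − η(z))/(R + η(z))) · ‖v'(z, r)‖² d(z, r) = ½ ∫_{Ω_{η'}} ‖v'(φ⁻¹(z, r))‖² d(z, r) − ½ ∫_{Ω_η} ‖v(z, r)‖² d(z, r) + ½ ∫_{Ω_η} ‖v'(z, r) − v(z, r)‖² d(z, r). -/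
open MeasureTheory
open scoped InnerProductSpace

/-- The fluid domain associated with a radial interface displacement `η`:
`Ω_η = {(z, r) : 0 < z < L, 0 < r < R + η z}`. -/
def fluidDomain (L R : ℝ) (η : ℝ → ℝ) : Set (ℝ × ℝ) :=
  {p : ℝ × ℝ | 0 < p.1 ∧ p.1 < L ∧ 0 < p.2 ∧ p.2 < R + η p.1}

theorem isOpen_fluidDomain (L R : ℝ) {η : ℝ → ℝ} (hη : Continuous η) :
    IsOpen (fluidDomain L R η) :=
  (isOpen_lt continuous_const continuous_fst).inter <|
    (isOpen_lt continuous_fst continuous_const).inter <|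
      (isOpen_lt continuous_const continuous_snd).inter <|
        isOpen_lt continuous_snd (continuous_const.add (hη.comp continuous_fst))

theorem image_aleMap_fluidDomain {L R : ℝ} {η η' : ℝ → ℝ}
    (hpos : ∀ z ∈ Set.Icc (0 : ℝ) L, 0 < R + η z)
    (hpos' : ∀ z ∈ Set.Icc (0 : ℝ) L, 0 < R + η' z) :
    (fun p : ℝ × ℝ => (p.1, (R + η' p.1) / (R + η p.1) * p.2)) '' fluidDomain L R η =
      fluidDomain L R η' := by
  ext ⟨z, r⟩
  constructor
  · rintro ⟨⟨z, r⟩, ⟨h0, hL, hr0, hr⟩, h⟩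
    obtain ⟨rfl, rfl⟩ := Prod.mk.inj h
    have h1 := hpos z ⟨h0.le, hL.le⟩
    have h2 := hpos' z ⟨h0.le, hL.le⟩
    refine ⟨h0, hL, by positivity, ?_⟩
    dsimp only at hr ⊢
    rw [div_mul_eq_mul_div, div_lt_iff₀ h1]
    gcongr
  · rintro ⟨h0, hL, hr0, hr⟩
    dsimp only at h0 hL hr0 hr
    have h1 := hpos z ⟨h0.le, hL.le⟩
    have h2 := hpos' z ⟨h0.le, hL.le⟩
    refine ⟨(z, (R + η z) / (R + η' z) * r), ⟨h0, hL, by positivity, ?_⟩, ?_⟩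
    · dsimp only
      rw [div_mul_eq_mul_div, div_lt_iff₀ h2]
      gcongr
    · ext
      · rfl
      · dsimp only
        field_simp

/-- Change of variables for a fibrewise scaling `(z, r) ↦ (z, c z * r)` of the plane. -/
theorem integral_image_fibre_scaling {E : Type*} [NormedAddCommGroup E] [NormedSpace ℝ E]
    {s : Set (ℝ × ℝ)} (hs : MeasurableSet s) {c : ℝ → ℝ}
    (hc : ∀ p ∈ s, DifferentiableAt ℝ c p.1) (hc0 : ∀ p ∈ s, 0 < c p.1) (g : ℝ × ℝ → E) :
    ∫ p in (fun p : ℝ × ℝ => (p.1, c p.1 * p.2)) '' s, g p =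
      ∫ p in s, c p.1 • g (p.1, c p.1 * p.2) := by
  set D : ℝ × ℝ → (ℝ × ℝ →L[ℝ] ℝ × ℝ) := fun p =>
    (Matrix.toLin (.finTwoProd ℝ) (.finTwoProd ℝ)
      !![1, 0; deriv c p.1 * p.2, c p.1]).toContinuousLinearMap with hD
  have hderiv : ∀ p ∈ s,
      HasFDerivWithinAt (fun p : ℝ × ℝ => (p.1, c p.1 * p.2)) (D p) s p := by
    intro p hp
    refine HasFDerivAt.hasFDerivWithinAt ?_
    simp only [hD, Matrix.toLin_finTwoProd_toContinuousLinearMap]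
    convert!
      HasFDerivAt.prodMk (𝕜 := ℝ) hasFDerivAt_fst
        (((hc p hp).hasDerivAt.comp_hasFDerivAt p hasFDerivAt_fst).mul hasFDerivAt_snd) using 2
    · simp
    · simp [smul_smul, add_comm, mul_comm]
  have hinj : Set.InjOn (fun p : ℝ × ℝ => (p.1, c p.1 * p.2)) s := by
    rintro ⟨z, r⟩ hp ⟨z', r'⟩ - h
    obtain ⟨rfl, h⟩ := Prod.mk.inj h
    exact Prod.ext rfl (mul_left_cancel₀ (hc0 _ hp).ne' h)
  rw [integral_image_eq_integral_abs_det_fderiv_smul volume hs hderiv hinj]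
  refine setIntegral_congr_fun hs fun p hp => ?_
  have hdet : (D p).det = c p.1 := by
    simp [hD, LinearMap.det_toContinuousLinearMap, LinearMap.det_toLin, Matrix.det_fin_two_of]
  simp only [hdet, abs_of_pos (hc0 p hp)]

/-- The central kinetic-energy computation in the stability proof: with
`φ(z,r) = (z, ((R + η' z)/(R + η z)) r)` the ALE bijection from `Ω_η` onto `Ω_{η'}`
(whose inverse is `φ⁻¹(z,r) = (z, ((R + η z)/(R + η' z)) r)`),
`∫_{Ω_η} ⟨v' − v, v'⟩ + ½ ∫_{Ω_η} ((η' − η)/(R + η)) ‖v'‖²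
  = ½ ∫_{Ω_{η'}} ‖v' ∘ φ⁻¹‖² − ½ ∫_{Ω_η} ‖v‖² + ½ ∫_{Ω_η} ‖v' − v‖²`. -/
theorem discrete_kinetic_energy_identity (L R : ℝ) (hL : 0 < L) (hR : 0 < R)
    (η η' : ℝ → ℝ) (hη : ContDiff ℝ 1 η) (hη' : ContDiff ℝ 1 η')
    (hpos : ∀ z ∈ Set.Icc (0 : ℝ) L, 0 < R + η z)
    (hpos' : ∀ z ∈ Set.Icc (0 : ℝ) L, 0 < R + η' z)
    (v v' : ℝ × ℝ → EuclideanSpace ℝ (Fin 2))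
    (hv : Measurable v) (hv' : Measurable v')
    (hintv : IntegrableOn (fun p => ‖v p‖ ^ 2) (fluidDomain L R η) volume)
    (hintv' : IntegrableOn (fun p => ‖v' p‖ ^ 2) (fluidDomain L R η) volume) :
    (∫ p in fluidDomain L R η, ⟪v' p - v p, v' p⟫_ℝ) +
        (1 / 2) * ∫ p in fluidDomain L R η,
          ((η' p.1 - η p.1) / (R + η p.1)) * ‖v' p‖ ^ 2 =
      (1 / 2) * (∫ p in fluidDomain L R η',
          ‖v' (p.1, ((R + η p.1) / (R + η' p.1)) * p.2)‖ ^ 2) -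
        (1 / 2) * (∫ p in fluidDomain L R η, ‖v p‖ ^ 2) +
        (1 / 2) * ∫ p in fluidDomain L R η, ‖v' p - v p‖ ^ 2 := by
  have hs : MeasurableSet (fluidDomain L R η) :=
    (isOpen_fluidDomain L R hη.continuous).measurableSet
  have hz : ∀ p ∈ fluidDomain L R η, p.1 ∈ Set.Icc (0 : ℝ) L := fun p hp => ⟨hp.1.le, hp.2.1.le⟩
  have hchange : ∫ p in fluidDomain L R η',
      ‖v' (p.1, ((R + η p.1) / (R + η' p.1)) * p.2)‖ ^ 2 =
        ∫ p in fluidDomain L R η, ((R + η' p.1) / (R + η p.1)) * ‖v' p‖ ^ 2 := by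
    rw [← image_aleMap_fluidDomain hpos hpos',
      integral_image_fibre_scaling (c := fun z => (R + η' z) / (R + η z)) hs
        (fun p hp => ((hη'.differentiable one_ne_zero p.1).const_add R).div
          ((hη.differentiable one_ne_zero p.1).const_add R) (hpos _ (hz p hp)).ne')
        (fun p hp => div_pos (hpos' _ (hz p hp)) (hpos _ (hz p hp)))]
    refine setIntegral_congr_fun hs fun p hp => ?_
    have h1 := (hpos _ (hz p hp)).ne'
    have h2 := (hpos' _ (hz p hp)).ne'
    have hcancel : (R + η p.1) / (R + η' p.1) * ((R + η' p.1) / (R + η p.1) * p.2) = p.2 := by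
      field_simp
    simp only [hcancel, smul_eq_mul]
  have hintw : IntegrableOn (fun p => ((η' p.1 - η p.1) / (R + η p.1)) * ‖v' p‖ ^ 2)
      (fluidDomain L R η) := by
    obtain ⟨C, hC⟩ := isCompact_Icc.exists_bound_of_continuousOn
      (f := fun z => (η' z - η z) / (R + η z))
      ((hη'.continuous.sub hη.continuous).continuousOn.div
        (continuous_const.add hη.continuous).continuousOn fun z hz => (hpos z hz).ne')
    have hmη := hη.continuous.measurable
    have hmη' := hη'.continuous.measurable
    exact hintv'.bdd_mul (c := C)
      (Measurable.aestronglyMeasurable (by fun_prop))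
      (ae_restrict_of_forall_mem hs fun p hp => hC _ (hz p hp))
  have hintd : IntegrableOn (fun p => ‖v' p - v p‖ ^ 2) (fluidDomain L R η) :=
    (memLp_two_iff_integrable_sq_norm (hv'.sub hv).aestronglyMeasurable).1 <|
      ((memLp_two_iff_integrable_sq_norm hv'.aestronglyMeasurable).2 hintv').sub
        ((memLp_two_iff_integrable_sq_norm hv.aestronglyMeasurable).2 hintv)
  have hconservation : ∫ p in fluidDomain L R η, ((R + η' p.1) / (R + η p.1)) * ‖v' p‖ ^ 2 =
      (∫ p in fluidDomain L R η, ‖v' p‖ ^ 2) +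
        ∫ p in fluidDomain L R η, ((η' p.1 - η p.1) / (R + η p.1)) * ‖v' p‖ ^ 2 := by
    rw [← integral_add hintv' hintw]
    refine setIntegral_congr_fun hs fun p hp => ?_
    have h1 := (hpos _ (hz p hp)).ne'
    field_simp
    ring
  have hinner : ∫ p in fluidDomain L R η, ⟪v' p - v p, v' p⟫_ℝ =
      (1 / 2) * ((∫ p in fluidDomain L R η, ‖v' p‖ ^ 2) -
        (∫ p in fluidDomain L R η, ‖v p‖ ^ 2) +
        ∫ p in fluidDomain L R η, ‖v' p - v p‖ ^ 2) := by
    rw [← integral_sub hintv' hintv,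
      ← integral_add (f := fun p => ‖v' p‖ ^ 2 - ‖v p‖ ^ 2) (Integrable.sub hintv' hintv) hintd,
      ← integral_const_mul]
    congr 1 with p
    rw [norm_sub_sq_real, inner_sub_left, real_inner_self_eq_norm_sq,
      real_inner_comm]
    ring
  rw [hchange, hconservation, hinner]
  ring
end

section
/- Let H be a real inner product space, let a : H × H → ℝ be a bilinear form with a(v, v) ≥ 0 for all v ∈ H, let F : H → ℝ be linear with F(v)² ≤ M · a(v, v) for all v ∈ H and some M ≥ 0, and let ρ_f > 0, Δt > 0. If v⁰, v¹ ∈ H satisfy ρ_f · ⟨(v¹ − v⁰)/Δt, φ⟩ + a(v¹, φ) = F(φ) for every φ ∈ H, then (ρ_f/2) ‖v¹‖² + (ρ_f/2) ‖v¹ − v⁰‖² + (Δt/2) · a(v¹, v¹) ≤ (ρ_f/2) ‖v⁰‖² + (Δt/2) · M. -/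
open scoped InnerProductSpace

/-- One-step unconditional stability bound for the backward-Euler fluid sub-problem:
if `a(v,v) ≥ 0`, `F(v)² ≤ M a(v,v)` with `M ≥ 0`, and
`ρ_f ⟨(v¹ − v⁰)/Δt, φ⟩ + a(v¹, φ) = F(φ)` for all `φ`, then
`(ρ_f/2)‖v¹‖² + (ρ_f/2)‖v¹ − v⁰‖² + (Δt/2) a(v¹, v¹) ≤ (ρ_f/2)‖v⁰‖² + (Δt/2) M`. -/
theorem fluid_substep_stability_bound
    {H : Type*} [NormedAddCommGroup H] [InnerProductSpace ℝ H]
    (a : H →ₗ[ℝ] H →ₗ[ℝ] ℝ) (ha : ∀ v : H, 0 ≤ a v v)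
    (F : H →ₗ[ℝ] ℝ) (M : ℝ) (hM : 0 ≤ M) (hF : ∀ v : H, (F v) ^ 2 ≤ M * a v v)
    (ρf Δt : ℝ) (hρf : 0 < ρf) (hΔt : 0 < Δt)
    (v0 v1 : H)
    (h : ∀ φ : H, ρf * ⟪Δt⁻¹ • (v1 - v0), φ⟫_ℝ + a v1 φ = F φ) :
    ρf / 2 * ‖v1‖ ^ 2 + ρf / 2 * ‖v1 - v0‖ ^ 2 + Δt / 2 * a v1 v1 ≤
      ρf / 2 * ‖v0‖ ^ 2 + Δt / 2 * M := by
  have young : F v1 ≤ (M + a v1 v1) / 2 := by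
    refine (abs_le_of_sq_le_sq' ?_ (by linarith [ha v1])).2
    linarith [hF v1, sq_nonneg (M - a v1 v1)]
  have energy : ρf * ⟪v1 - v0, v1⟫_ℝ + Δt * a v1 v1 = Δt * F v1 := by
    rw [← h v1, real_inner_smul_left]
    field_simp
  have polarization : ‖v0‖ ^ 2 = ‖v1 - v0‖ ^ 2 - 2 * ⟪v1 - v0, v1⟫_ℝ + ‖v1‖ ^ 2 := by
    rw [← norm_sub_sq_real, sub_sub_cancel_left, norm_neg]
  rw [polarization]
  linarith [mul_le_mul_of_nonneg_left young hΔt.le]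
end

section
/- Let H_f and H_s be real inner product spaces, let a_f : H_f × H_f → ℝ and a_v : H_s × H_s → ℝ be bilinear forms with a_f(v,v) ≥ 0 and a_v(V,V) ≥ 0 for all v, V, let a_e : H_s × H_s → ℝ be a symmetric bilinear form with a_e(U,U) ≥ 0, let K ⊆ H_f × H_s be a linear subspace, and let ρ_f, ρ_s, Δt > 0 and N ∈ ℕ. Suppose given sequences v⁰, …, v^N ∈ H_f, U⁰, …, U^N ∈ H_s, V⁰, …, V^N ∈ H_s, intermediate velocities V^{n+1/2} ∈ H_s, linear functionals Fⁿ : H_f → ℝ and constants Mₙ ≥ 0 with Fⁿ(v)² ≤ Mₙ a_f(v,v) for all v, such that for every n < N: (i) structure step: ρ_s⟨V^{n+1/2} − Vⁿ, φ⟩ + Δt · a_e((Uⁿ + U^{n+1})/2, φ) = 0 for all φ ∈ H_s, and (Vⁿ + V^{n+1/2})/2 = (U^{n+1} − Uⁿ)/Δt; (ii) fluid step: (v^{n+1}, V^{n+1}) ∈ K and ρ_f⟨v^{n+1} − vⁿ, φ⟩ + Δt · a_f(v^{n+1}, φ) + ρ_s⟨V^{n+1} − V^{n+1/2}, ψ⟩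 + Δt · a_v(V^{n+1}, ψ) = Δt · Fⁿ(φ) for all (φ, ψ) ∈ K. Define Eⁿ = (ρ_f/2)‖vⁿ‖² + (ρ_s/2)‖Vⁿ‖² + ½ a_e(Uⁿ, Uⁿ). Then for every ñ ≤ N: E^{ñ} + Σ_{n<ñ} [ (ρ_f/2)‖v^{n+1} − vⁿ‖² + (ρ_s/2)‖V^{n+1} − V^{n+1/2}‖² + (Δt/2) a_f(v^{n+1}, v^{n+1}) + Δt · a_v(V^{n+1}, V^{n+1}) ] ≤ E⁰ + (Δt/2) Σ_{n<ñ} Mₙ. -/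
open scoped InnerProductSpace

/-- Polarization identity behind the energy balance of backward Euler. -/
theorem real_inner_sub_self_eq {H : Type*} [NormedAddCommGroup H] [InnerProductSpace ℝ H]
    (a b : H) : ⟪a - b, a⟫_ℝ = (‖a‖ ^ 2 - ‖b‖ ^ 2 + ‖a - b‖ ^ 2) / 2 := by
  rw [norm_sub_sq_real, inner_sub_left, real_inner_self_eq_norm_sq, real_inner_comm]
  ring

theorem real_inner_sub_add_eq {H : Type*} [NormedAddCommGroup H] [InnerProductSpace ℝ H]
    (a b : H) : ⟪a - b, b + a⟫_ℝ = ‖a‖ ^ 2 - ‖b‖ ^ 2 := by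
  rw [inner_sub_left, inner_add_right, inner_add_right, real_inner_self_eq_norm_sq,
    real_inner_self_eq_norm_sq, real_inner_comm b a]
  ring

/-- A symmetric bilinear form satisfies the difference-of-squares identity. -/
theorem bilin_add_sub_eq {H : Type*} [AddCommGroup H] [Module ℝ H]
    (a : H →ₗ[ℝ] H →ₗ[ℝ] ℝ) (ha : ∀ x y, a x y = a y x) (x y : H) :
    a (x + y) (y - x) = a y y - a x x := by
  simp only [map_add, map_sub, LinearMap.add_apply, ha y x]
  ring

/-- The midpoint Newmark step conserves the structure energy exactly. -/
theorem midpoint_step_energy_eq {H : Type*} [NormedAddCommGroup H] [InnerProductSpace ℝ H]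
    (a : H →ₗ[ℝ] H →ₗ[ℝ] ℝ) (ha : ∀ x y, a x y = a y x) {ρ τ : ℝ} (hτ : 0 < τ)
    {U U' V V' : H}
    (hdyn : ∀ φ, ρ * ⟪V' - V, φ⟫_ℝ + τ * a ((2 : ℝ)⁻¹ • (U + U')) φ = 0)
    (hkin : (2 : ℝ)⁻¹ • (V + V') = τ⁻¹ • (U' - U)) :
    ρ / 2 * ‖V'‖ ^ 2 + 1 / 2 * a U' U' = ρ / 2 * ‖V‖ ^ 2 + 1 / 2 * a U U := by
  have h := hdyn ((2 : ℝ)⁻¹ • (V + V'))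
  rw [inner_smul_right, real_inner_sub_add_eq, hkin] at h
  simp only [map_smul, LinearMap.smul_apply, smul_eq_mul, bilin_add_sub_eq a ha] at h
  field_simp at h
  linarith

theorem le_half_add_of_sq_le_mul {x m a : ℝ} (hm : 0 ≤ m) (ha : 0 ≤ a) (h : x ^ 2 ≤ m * a) :
    x ≤ (m + a) / 2 :=
  le_of_abs_le <| abs_le_of_sq_le_sq (by nlinarith [sq_nonneg (m - a)]) (by positivity)

/-- Energy estimate expressing unconditional stability of the Lie operator-splitting
scheme (β = 0) for the FSI problem: the structure sub-problem is discretized by the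
midpoint Newmark scheme, the fluid sub-problem (including the structure inertia and
structural viscosity, coupled through the subspace `K` of pairs of test functions)
by backward Euler; the total discrete energy plus the accumulated numerical and
viscous dissipation is bounded by the initial energy and the work of the pressure
data, with no restriction on `Δt`. -/
theorem operator_splitting_energy_estimate
    {Hf Hs : Type*} [NormedAddCommGroup Hf] [InnerProductSpace ℝ Hf]
    [NormedAddCommGroup Hs] [InnerProductSpace ℝ Hs]
    (af : Hf →ₗ[ℝ] Hf →ₗ[ℝ] ℝ) (av ae : Hs →ₗ[ℝ] Hs →ₗ[ℝ] ℝ)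
    (haf : ∀ x : Hf, 0 ≤ af x x) (hav : ∀ x : Hs, 0 ≤ av x x)
    (hae_symm : ∀ x y : Hs, ae x y = ae y x) (hae : ∀ x : Hs, 0 ≤ ae x x)
    (K : Submodule ℝ (Hf × Hs))
    (ρf ρs Δt : ℝ) (hρf : 0 < ρf) (hρs : 0 < ρs) (hΔt : 0 < Δt)
    (N : ℕ) (v : ℕ → Hf) (U V Vh : ℕ → Hs)
    (F : ℕ → Hf →ₗ[ℝ] ℝ) (M : ℕ → ℝ) (hM : ∀ n, 0 ≤ M n)
    (hF : ∀ n, ∀ w : Hf, (F n w) ^ 2 ≤ M n * af w w)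
    (hstr1 : ∀ n < N, ∀ φ : Hs,
      ρs * ⟪Vh n - V n, φ⟫_ℝ + Δt * ae ((2 : ℝ)⁻¹ • (U n + U (n + 1))) φ = 0)
    (hstr2 : ∀ n < N, (2 : ℝ)⁻¹ • (V n + Vh n) = Δt⁻¹ • (U (n + 1) - U n))
    (hK : ∀ n < N, (v (n + 1), V (n + 1)) ∈ K)
    (hfl : ∀ n < N, ∀ p ∈ K,
      ρf * ⟪v (n + 1) - v n, (p : Hf × Hs).1⟫_ℝ + Δt * af (v (n + 1)) (p : Hf × Hs).1 +
          ρs * ⟪V (n + 1) - Vh n, (p : Hf × Hs).2⟫_ℝ + Δt * av (V (n + 1)) (p : Hf × Hs).2 =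
        Δt * F n (p : Hf × Hs).1) :
    ∀ nt ≤ N,
      (ρf / 2 * ‖v nt‖ ^ 2 + ρs / 2 * ‖V nt‖ ^ 2 + (1 / 2) * ae (U nt) (U nt)) +
          ∑ n ∈ Finset.range nt,
            (ρf / 2 * ‖v (n + 1) - v n‖ ^ 2 + ρs / 2 * ‖V (n + 1) - Vh n‖ ^ 2 +
              Δt / 2 * af (v (n + 1)) (v (n + 1)) + Δt * av (V (n + 1)) (V (n + 1))) ≤
        (ρf / 2 * ‖v 0‖ ^ 2 + ρs / 2 * ‖V 0‖ ^ 2 + (1 / 2) * ae (U 0) (U 0)) +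
          Δt / 2 * ∑ n ∈ Finset.range nt, M n := by
  intro nt
  induction nt with
  | zero => simp
  | succ n ih =>
    intro hn
    have ih := ih (by omega)
    have hs := midpoint_step_energy_eq ae hae_symm hΔt (hstr1 n hn) (hstr2 n hn)
    have hf := hfl n hn _ (hK n hn)
    simp only [real_inner_sub_self_eq] at hf
    have hwork := mul_le_mul_of_nonneg_left
      (le_half_add_of_sq_le_mul (hM n) (haf (v (n + 1))) (hF n (v (n + 1)))) hΔt.le
    rw [Finset.sum_range_succ, Finset.sum_range_succ]
    linarith
end
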